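/- arXiv:1203.4124 — 2 statements merged into one kernel-verified Lean document; each statement's English description precedes it below -/
import Mathlib

section
/- Let p ≥ 2 and K > 0. There exists a constant C > 0, depending only on p and K, such that for every real Banach space B with modulus of uniform convexity η(ε) = K ε^p, every f ∈ ℓ^p(B), and every strictly increasing sequence (n_k)_{k∈ℕ} of natural numbers, ∑_{k≥0} ‖ℰ_{n_{k+1}} f − ℰ_{n_k} f‖_{ℓ^p(B)}^p ≤ C ‖f‖_{ℓ^p(B)}^p. -/
open Finset ENNReal NNReal

/-- The dyadic expectation `(ℰ_n f)(x)`: the average of `f` over the dyadic interval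
`[h·2ⁿ, (h+1)·2ⁿ)` of length `2ⁿ` containing `x`, where `h = ⌊x / 2ⁿ⌋`. -/
noncomputable def dyadicExp {B : Type*} [AddCommGroup B] [Module ℝ B]
    (n : ℕ) (f : ℤ → B) (x : ℤ) : B :=
  ((2 : ℝ) ^ n)⁻¹ • ∑ j ∈ Finset.range (2 ^ n), f (Int.fdiv x (2 ^ n) * 2 ^ n + (j : ℤ))

/-- The constant in the midpoint inequality for a space with modulus of convexity `K ε ^ p`. -/
noncomputable def midpointConst (p K : ℝ) : ℝ :=
  min ((1 / 8) ^ p) ((1 / 2) ^ p * K * (3 / 4) ^ p)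

lemma midpointConst_pos {p K : ℝ} (hK : 0 < K) : 0 < midpointConst p K := by
  unfold midpointConst
  positivity

/-- `B` has modulus of uniform convexity `K ε ^ p`. -/
def HasPowerConvexity (B : Type*) [NormedAddCommGroup B] [NormedSpace ℝ B] (p K : ℝ) : Prop :=
  ∀ ε ∈ Set.Ioc (0 : ℝ) 2, ∀ x y : B, ‖x‖ ≤ 1 → ‖y‖ ≤ 1 → ε ≤ ‖x - y‖ →
    ‖(1 / 2 : ℝ) • (x + y)‖ ≤ 1 - K * ε ^ p

lemma add_div_two_rpow_le {p a b : ℝ} (hp : 1 ≤ p) (ha : 0 ≤ a) (hb : 0 ≤ b) :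
    ((a + b) / 2) ^ p ≤ (a ^ p + b ^ p) / 2 := by
  have h := (convexOn_rpow hp).2 (Set.mem_Ici.2 ha) (Set.mem_Ici.2 hb)
    (by norm_num : (0 : ℝ) ≤ 1 / 2) (by norm_num : (0 : ℝ) ≤ 1 / 2) (by norm_num)
  simp only [smul_eq_mul] at h
  calc ((a + b) / 2) ^ p = (1 / 2 * a + 1 / 2 * b) ^ p := by congr 1; ring
    _ ≤ 1 / 2 * a ^ p + 1 / 2 * b ^ p := h
    _ = (a ^ p + b ^ p) / 2 := by ring

lemma sq_rpow_half {p a : ℝ} (ha : 0 ≤ a) : (a ^ 2) ^ (p / 2) = a ^ p := by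
  rw [← Real.rpow_natCast, ← Real.rpow_mul ha]
  congr 1
  push_cast
  ring

/-- Clarkson's inequality for two real numbers. -/
lemma clarkson_real {p a b : ℝ} (hp : 2 ≤ p) (hb : 0 ≤ b) (hab : b ≤ a) :
    ((a + b) / 2) ^ p + ((a - b) / 2) ^ p ≤ (a ^ p + b ^ p) / 2 := by
  have ha : 0 ≤ a := hb.trans hab
  have hs : 0 ≤ (a + b) / 2 := by linarith
  have hd : 0 ≤ (a - b) / 2 := by linarith
  have hp' : 1 ≤ p / 2 := by linarith
  calc ((a + b) / 2) ^ p + ((a - b) / 2) ^ p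
      = (((a + b) / 2) ^ 2) ^ (p / 2) + (((a - b) / 2) ^ 2) ^ (p / 2) := by
        rw [sq_rpow_half hs, sq_rpow_half hd]
    _ ≤ (((a + b) / 2) ^ 2 + ((a - b) / 2) ^ 2) ^ (p / 2) :=
        Real.add_rpow_le_rpow_add (sq_nonneg _) (sq_nonneg _) hp'
    _ = ((a ^ 2 + b ^ 2) / 2) ^ (p / 2) := by congr 1; ring
    _ ≤ ((a ^ 2) ^ (p / 2) + (b ^ 2) ^ (p / 2)) / 2 :=
        add_div_two_rpow_le hp' (sq_nonneg _) (sq_nonneg _)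
    _ = (a ^ p + b ^ p) / 2 := by rw [sq_rpow_half ha, sq_rpow_half hb]

lemma sub_rpow_le {p t δ : ℝ} (hp : 1 ≤ p) (ht : 1 / 2 ≤ t) (hδ : 0 ≤ δ) (hδt : δ ≤ t) :
    (t - δ) ^ p ≤ t ^ p - (1 / 2) ^ p * (2 * δ) := by
  have ht0 : 0 < t := by linarith
  have hq0 : 0 ≤ 1 - δ / t := by
    rw [sub_nonneg, div_le_one ht0]
    exact hδt
  have hq1 : 1 - δ / t ≤ 1 := by
    have : 0 ≤ δ / t := by positivity
    linarith
  have hpow : (1 / 2 : ℝ) ^ p * 2 ≤ t ^ p / t := by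
    have h : (1 / 2 : ℝ) ^ (p - 1) ≤ t ^ (p - 1) :=
      Real.rpow_le_rpow (by norm_num) ht (by linarith)
    rw [Real.rpow_sub_one (by norm_num), Real.rpow_sub_one ht0.ne'] at h
    linarith
  calc (t - δ) ^ p = (t * (1 - δ / t)) ^ p := by congr 1; field_simp
    _ = t ^ p * (1 - δ / t) ^ p := Real.mul_rpow ht0.le hq0
    _ ≤ t ^ p * (1 - δ / t) := by
        gcongr
        exact Real.rpow_le_self_of_le_one hq0 hq1 hp
    _ = t ^ p - t ^ p / t * δ := by ring
    _ ≤ t ^ p - (1 / 2) ^ p * 2 * δ := by gcongr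
    _ = t ^ p - (1 / 2) ^ p * (2 * δ) := by ring

section

variable {B : Type*} [NormedAddCommGroup B] [NormedSpace ℝ B] {p K : ℝ}

lemma norm_half_smul_add_le (x y : B) : ‖(1 / 2 : ℝ) • (x + y)‖ ≤ (‖x‖ + ‖y‖) / 2 := by
  rw [norm_smul, Real.norm_of_nonneg (by norm_num)]
  linarith [norm_add_le x y]

lemma HasPowerConvexity.midpoint_of_norm_eq_one (hB : HasPowerConvexity B p K) (hp : 2 ≤ p)
    (hK : 0 < K) {x y : B} (hx : ‖x‖ ≤ 1) (hy : ‖y‖ = 1) :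
    ‖(1 / 2 : ℝ) • (x + y)‖ ^ p + midpointConst p K * ‖x - y‖ ^ p ≤ (‖x‖ ^ p + ‖y‖ ^ p) / 2 := by
  have hmid := norm_half_smul_add_le x y
  have hle2 : ‖x - y‖ ≤ 2 := (norm_sub_le x y).trans (by linarith)
  have hx0 := norm_nonneg x
  rw [hy] at hmid ⊢
  rcases le_or_gt (‖x - y‖ / 4) (1 - ‖x‖) with h | h
  · have hcl := clarkson_real hp hx0 hx
    have hc : midpointConst p K * ‖x - y‖ ^ p ≤ ((1 - ‖x‖) / 2) ^ p := by
      calc midpointConst p K * ‖x - y‖ ^ p ≤ (1 / 8) ^ p * ‖x - y‖ ^ p := by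
            gcongr
            exact min_le_left _ _
        _ = (1 / 8 * ‖x - y‖) ^ p := (Real.mul_rpow (by norm_num) (norm_nonneg _)).symm
        _ ≤ ((1 - ‖x‖) / 2) ^ p :=
            Real.rpow_le_rpow (by positivity) (by linarith) (by linarith)
    have hm : ‖(1 / 2 : ℝ) • (x + y)‖ ^ p ≤ ((1 + ‖x‖) / 2) ^ p :=
      Real.rpow_le_rpow (norm_nonneg _) (by linarith) (by linarith)
    rw [Real.one_rpow] at *
    linarith
  · set s := ‖x‖ with hs
    have hs2 : 1 / 2 < s := by linarith
    have hs0 : 0 < s := by linarith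
    have hε : 0 < ‖x - y‖ := by linarith
    have hxs : ‖s⁻¹ • x‖ = 1 := by
      rw [norm_smul, norm_inv, Real.norm_of_nonneg hx0, ← hs, inv_mul_cancel₀ hs0.ne']
    have hxeq : s • (s⁻¹ • x) = x := smul_inv_smul₀ hs0.ne' x
    generalize s⁻¹ • x = u at hxs hxeq
    have hdist : 3 / 4 * ‖x - y‖ ≤ ‖u - y‖ := by
      have h1 : ‖x - y‖ ≤ ‖s • (u - y)‖ + ‖(1 - s) • y‖ := by
        have : x - y = s • (u - y) - (1 - s) • y := by rw [← hxeq]; module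
        rw [this]
        exact norm_sub_le _ _
      rw [norm_smul, norm_smul, hy, Real.norm_of_nonneg hx0,
        Real.norm_of_nonneg (by linarith)] at h1
      nlinarith [norm_nonneg (u - y)]
    have hconv := hB (3 / 4 * ‖x - y‖) ⟨by positivity, by linarith⟩ u y hxs.le hy.le hdist
    set η := K * (3 / 4 * ‖x - y‖) ^ p with hη
    have hη0 : 0 ≤ η := by positivity
    have hη1 : η ≤ 1 := by linarith [norm_nonneg ((1 / 2 : ℝ) • (u + y))]
    have hm : ‖(1 / 2 : ℝ) • (x + y)‖ ≤ (s + 1) / 2 - η / 2 := by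
      have : (1 / 2 : ℝ) • (x + y) = s • ((1 / 2 : ℝ) • (u + y)) + ((1 - s) / 2) • y := by
        rw [← hxeq]
        module
      rw [this]
      refine (norm_add_le _ _).trans ?_
      rw [norm_smul s, norm_smul _ y, hy, Real.norm_of_nonneg hx0, Real.norm_of_nonneg (by linarith)]
      nlinarith
    have hsub : ((s + 1) / 2 - η / 2) ^ p ≤ ((s + 1) / 2) ^ p - (1 / 2) ^ p * (2 * (η / 2)) :=
      sub_rpow_le (by linarith) (by linarith) (by linarith) (by linarith)
    have hm' := Real.rpow_le_rpow (norm_nonneg _) hm (by linarith : 0 ≤ p)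
    have hcv := add_div_two_rpow_le (by linarith : 1 ≤ p) hx0 zero_le_one
    have hc : midpointConst p K * ‖x - y‖ ^ p ≤ (1 / 2) ^ p * (2 * (η / 2)) := by
      calc midpointConst p K * ‖x - y‖ ^ p
          ≤ (1 / 2) ^ p * K * (3 / 4) ^ p * ‖x - y‖ ^ p := by
            gcongr
            exact min_le_right _ _
        _ = (1 / 2) ^ p * (2 * (η / 2)) := by
            rw [hη, Real.mul_rpow (by norm_num) (norm_nonneg _)]
            ring
    linarith

lemma HasPowerConvexity.midpoint_of_norm_le (hB : HasPowerConvexity B p K) (hp : 2 ≤ p)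
    (hK : 0 < K) {x y : B} (hxy : ‖x‖ ≤ ‖y‖) :
    ‖(1 / 2 : ℝ) • (x + y)‖ ^ p + midpointConst p K * ‖x - y‖ ^ p ≤ (‖x‖ ^ p + ‖y‖ ^ p) / 2 := by
  rcases (norm_nonneg y).eq_or_lt with h0 | h0
  · have hy : y = 0 := norm_eq_zero.1 h0.symm
    have hx : x = 0 := norm_le_zero_iff.1 (hxy.trans h0.ge)
    simp [hx, hy, Real.zero_rpow (by linarith : p ≠ 0)]
  · set r := ‖y‖ with hr
    have hscale : ∀ z : B, ‖r⁻¹ • z‖ = r⁻¹ * ‖z‖ := fun z => by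
      rw [norm_smul, norm_inv, Real.norm_of_nonneg h0.le]
    have hscale' : ∀ z : B, ‖r⁻¹ • z‖ ^ p = r⁻¹ ^ p * ‖z‖ ^ p := fun z => by
      rw [hscale, Real.mul_rpow (inv_nonneg.2 h0.le) (norm_nonneg _)]
    have h := hB.midpoint_of_norm_eq_one hp hK (x := r⁻¹ • x) (y := r⁻¹ • y)
      (by rw [hscale, inv_mul_le_one₀ h0]; exact hxy)
      (by rw [hscale, ← hr, inv_mul_cancel₀ h0.ne'])
    rw [← smul_add, ← smul_sub, smul_comm, hscale', hscale', hscale', hscale'] at h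
    have hpos : 0 < r⁻¹ ^ p := by positivity
    refine le_of_mul_le_mul_left ?_ hpos
    linarith

/-- Pisier's midpoint inequality in a space with modulus of convexity `K ε ^ p`. -/
lemma HasPowerConvexity.midpoint (hB : HasPowerConvexity B p K) (hp : 2 ≤ p) (hK : 0 < K)
    (x y : B) :
    ‖(1 / 2 : ℝ) • (x + y)‖ ^ p + midpointConst p K * ‖x - y‖ ^ p ≤ (‖x‖ ^ p + ‖y‖ ^ p) / 2 := by
  rcases le_total ‖x‖ ‖y‖ with h | h
  · exact hB.midpoint_of_norm_le hp hK h
  · rw [add_comm x y, norm_sub_rev x y, add_comm (‖x‖ ^ p)]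
    exact hB.midpoint_of_norm_le hp hK h

/-- Jensen's inequality for `‖·‖ ^ p` and a uniform average. -/
lemma card_mul_norm_average_rpow_le (hp : 1 ≤ p) {N : ℕ} (hN : 0 < N) (a : ℕ → B) :
    N * ‖(N : ℝ)⁻¹ • ∑ j ∈ range N, a j‖ ^ p ≤ ∑ j ∈ range N, ‖a j‖ ^ p := by
  have hN' : (0 : ℝ) < N := by exact_mod_cast hN
  have hnorm : ‖(N : ℝ)⁻¹ • ∑ j ∈ range N, a j‖ ≤ ∑ j ∈ range N, (N : ℝ)⁻¹ * ‖a j‖ := by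
    rw [norm_smul, norm_inv, Real.norm_of_nonneg hN'.le, ← mul_sum]
    gcongr
    exact norm_sum_le _ _
  have hjensen := Real.rpow_arith_mean_le_arith_mean_rpow (range N) (fun _ => (N : ℝ)⁻¹)
    (fun j => ‖a j‖) (fun _ _ => by positivity) (by simp [hN'.ne'])
    (fun _ _ => norm_nonneg _) hp
  have h := (Real.rpow_le_rpow (norm_nonneg _) hnorm (by linarith)).trans hjensen
  rw [← mul_sum] at h
  calc (N : ℝ) * ‖(N : ℝ)⁻¹ • ∑ j ∈ range N, a j‖ ^ p
      ≤ N * ((N : ℝ)⁻¹ * ∑ j ∈ range N, ‖a j‖ ^ p) := by gcongr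
    _ = ∑ j ∈ range N, ‖a j‖ ^ p := by field_simp

/-- The quantitative form of Jensen's inequality given by uniform convexity. -/
lemma HasPowerConvexity.average (hB : HasPowerConvexity B p K) (hp : 2 ≤ p) (hK : 0 < K)
    {N : ℕ} (hN : 0 < N) (a : ℕ → B) {m : B} (hm : (N : ℝ)⁻¹ • ∑ j ∈ range N, a j = m) :
    N * ‖m‖ ^ p + 2 * midpointConst p K * ∑ j ∈ range N, ‖m - a j‖ ^ p
      ≤ ∑ j ∈ range N, ‖a j‖ ^ p := by
  have hN' : (N : ℝ) ≠ 0 := by exact_mod_cast hN.ne'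
  have hmean : (N : ℝ)⁻¹ • ∑ j ∈ range N, (1 / 2 : ℝ) • (a j + m) = m := by
    rw [← smul_sum, sum_add_distrib, sum_const, card_range, smul_comm, smul_add, hm,
      ← Nat.cast_smul_eq_nsmul ℝ, inv_smul_smul₀ hN']
    module
  have hjensen := card_mul_norm_average_rpow_le (by linarith : 1 ≤ p) hN
    (fun j => (1 / 2 : ℝ) • (a j + m))
  rw [hmean] at hjensen
  have hsum := sum_le_sum fun j (_ : j ∈ range N) => hB.midpoint hp hK (a j) m
  rw [sum_add_distrib, ← mul_sum, ← sum_div, sum_add_distrib, sum_const, card_range,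
    nsmul_eq_mul] at hsum
  simp_rw [norm_sub_rev m]
  linarith

end

lemma sum_range_mul_eq {M : Type*} [AddCommMonoid M] (g : ℕ → M) (q N : ℕ) :
    ∑ j ∈ range (q * N), g j = ∑ i ∈ range q, ∑ r ∈ range N, g (i * N + r) := by
  induction q with
  | zero => simp
  | succ q ih => rw [Nat.succ_mul, sum_range_add, ih, sum_range_succ]

lemma tsum_int_eq_tsum_blocks (N : ℕ) (hN : 0 < N) (F : ℤ → ℝ≥0∞) :
    ∑' x, F x = ∑' h : ℤ, ∑ j ∈ range N, F (h * N + j) := by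
  have : NeZero N := ⟨hN.ne'⟩
  rw [← (Int.divModEquiv N).symm.tsum_eq F, ENNReal.tsum_prod']
  refine tsum_congr fun h => ?_
  rw [tsum_fintype, ← Fin.sum_univ_eq_sum_range (fun j => F (h * N + j))]
  rfl

lemma ofReal_norm_rpow {B : Type*} [NormedAddCommGroup B] {p : ℝ} (hp : 0 ≤ p) (b : B) :
    ENNReal.ofReal (‖b‖ ^ p) = (‖b‖₊ : ℝ≥0∞) ^ p := by
  rw [← ENNReal.ofReal_rpow_of_nonneg (norm_nonneg b) hp, ofReal_norm, enorm_eq_nnnorm]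

section

variable {B : Type*}

lemma dyadicExp_block [AddCommGroup B] [Module ℝ B] (n : ℕ) (f : ℤ → B) (h : ℤ) {j : ℕ}
    (hj : j < 2 ^ n) :
    dyadicExp n f (h * (2 ^ n : ℕ) + j)
      = ((2 ^ n : ℕ) : ℝ)⁻¹ • ∑ i ∈ range (2 ^ n), f (h * (2 ^ n : ℕ) + i) := by
  have hpos : (0 : ℤ) < (2 ^ n : ℕ) := by positivity
  have hdiv : Int.fdiv (h * (2 ^ n : ℕ) + j) (2 ^ n : ℕ) = h := by
    rw [Int.fdiv_eq_ediv_of_nonneg _ hpos.le, add_comm, Int.add_mul_ediv_right _ _ hpos.ne',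
      Int.ediv_eq_zero_of_lt (by positivity) (by exact_mod_cast hj), zero_add]
  push_cast at hdiv ⊢
  rw [dyadicExp, hdiv]

/-- The tower property of dyadic expectations, on one dyadic block. -/
lemma sum_dyadicExp_block [AddCommGroup B] [Module ℝ B] {m n : ℕ} (hmn : m ≤ n) (f : ℤ → B)
    (h : ℤ) :
    ∑ j ∈ range (2 ^ n), dyadicExp m f (h * (2 ^ n : ℕ) + j)
      = ∑ j ∈ range (2 ^ n), f (h * (2 ^ n : ℕ) + j) := by
  obtain ⟨d, rfl⟩ := Nat.exists_eq_add_of_le' hmn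
  have hrw : ∀ i r : ℕ, h * (2 ^ (d + m) : ℕ) + ((i * 2 ^ m + r : ℕ) : ℤ)
      = (h * 2 ^ d + i) * (2 ^ m : ℕ) + r := fun i r => by
    push_cast
    ring
  have hcard : 2 ^ (d + m) = 2 ^ d * 2 ^ m := pow_add 2 d m
  rw [show range (2 ^ (d + m)) = range (2 ^ d * 2 ^ m) by rw [hcard], sum_range_mul_eq,
    sum_range_mul_eq]
  refine sum_congr rfl fun i _ => ?_
  simp_rw [hrw]
  rw [sum_congr rfl fun r hr => dyadicExp_block m f _ (mem_range.1 hr), sum_const, card_range,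
    ← Nat.cast_smul_eq_nsmul ℝ, smul_inv_smul₀ (by positivity)]

variable [NormedAddCommGroup B] [NormedSpace ℝ B] {p K : ℝ}

lemma tsum_dyadicExp_rpow_le (hp : 1 ≤ p) (n : ℕ) (f : ℤ → B) :
    ∑' x : ℤ, (‖dyadicExp n f x‖₊ : ℝ≥0∞) ^ p ≤ ∑' x : ℤ, (‖f x‖₊ : ℝ≥0∞) ^ p := by
  have hN : 0 < 2 ^ n := by positivity
  rw [tsum_int_eq_tsum_blocks _ hN fun x => (‖dyadicExp n f x‖₊ : ℝ≥0∞) ^ p,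
    tsum_int_eq_tsum_blocks _ hN fun x => (‖f x‖₊ : ℝ≥0∞) ^ p]
  refine ENNReal.tsum_le_tsum fun h => ?_
  simp_rw [← ofReal_norm_rpow (by linarith : 0 ≤ p)]
  rw [← ENNReal.ofReal_sum_of_nonneg fun _ _ => by positivity,
    ← ENNReal.ofReal_sum_of_nonneg fun _ _ => by positivity]
  refine ENNReal.ofReal_le_ofReal ?_
  rw [sum_congr rfl fun j hj => by rw [dyadicExp_block n f h (mem_range.1 hj)], sum_const,
    card_range, nsmul_eq_mul]
  exact card_mul_norm_average_rpow_le hp hN fun j => f (h * (2 ^ n : ℕ) + j)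

/-- Passing to a coarser dyadic expectation lowers the `p`-th power of the `ℓ^p` norm by at least
a fixed multiple of the `p`-th power of the norm of the difference. -/
lemma HasPowerConvexity.tsum_dyadicExp_add_le (hB : HasPowerConvexity B p K) (hp : 2 ≤ p)
    (hK : 0 < K) {m n : ℕ} (hmn : m ≤ n) (f : ℤ → B) :
    ∑' x : ℤ, (‖dyadicExp n f x‖₊ : ℝ≥0∞) ^ p + ENNReal.ofReal (2 * midpointConst p K) *
        ∑' x : ℤ, (‖dyadicExp n f x - dyadicExp m f x‖₊ : ℝ≥0∞) ^ p
      ≤ ∑' x : ℤ, (‖dyadicExp m f x‖₊ : ℝ≥0∞) ^ p := by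
  have hN : 0 < 2 ^ n := by positivity
  have hc := (midpointConst_pos (p := p) hK).le
  rw [tsum_int_eq_tsum_blocks _ hN fun x => (‖dyadicExp n f x‖₊ : ℝ≥0∞) ^ p,
    tsum_int_eq_tsum_blocks _ hN fun x => (‖dyadicExp n f x - dyadicExp m f x‖₊ : ℝ≥0∞) ^ p,
    tsum_int_eq_tsum_blocks _ hN fun x => (‖dyadicExp m f x‖₊ : ℝ≥0∞) ^ p,
    ← ENNReal.tsum_mul_left, ← ENNReal.tsum_add]
  refine ENNReal.tsum_le_tsum fun h => ?_
  simp_rw [← ofReal_norm_rpow (by linarith : 0 ≤ p)]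
  rw [← ENNReal.ofReal_sum_of_nonneg fun _ _ => by positivity,
    ← ENNReal.ofReal_sum_of_nonneg fun _ _ => by positivity,
    ← ENNReal.ofReal_sum_of_nonneg fun _ _ => by positivity,
    ← ENNReal.ofReal_mul (by positivity), ← ENNReal.ofReal_add (by positivity) (by positivity)]
  refine ENNReal.ofReal_le_ofReal ?_
  have hblock := fun j (hj : j ∈ range (2 ^ n)) => dyadicExp_block n f h (mem_range.1 hj)
  rw [sum_congr rfl fun j hj => by rw [hblock j hj], sum_const, card_range, nsmul_eq_mul]
  have hdiff := sum_congr rfl fun (j : ℕ) hj =>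
    congrArg (fun b => ‖b - dyadicExp m f (h * (2 ^ n : ℕ) + j)‖ ^ p) (hblock j hj)
  refine (congrArg _ (congrArg _ hdiff)).trans_le ?_
  exact hB.average hp hK hN (fun j => dyadicExp m f (h * (2 ^ n : ℕ) + j))
    (by rw [sum_dyadicExp_block hmn])

end

lemma ENNReal.tsum_le_of_add_le {A D : ℕ → ℝ≥0∞} (h : ∀ k, A (k + 1) + D k ≤ A k) :
    ∑' k, D k ≤ A 0 := by
  refine ENNReal.tsum_le_of_sum_range_le fun N => ?_
  suffices A N + ∑ k ∈ range N, D k ≤ A 0 from le_add_self.trans this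
  induction N with
  | zero => simp
  | succ N ih =>
    rw [sum_range_succ, add_comm (∑ k ∈ range N, D k), ← add_assoc]
    exact (add_le_add_left (h N) _).trans ih

/-- For `p ≥ 2`, `K > 0` there is `C > 0` depending only on `p` and `K` such that for every real
Banach space `B` with modulus of uniform convexity `η(ε) = K ε^p`, every `f ∈ ℓ^p(B)` and every
strictly increasing sequence `(n k)` of naturals,
`∑ₖ ‖ℰ_{n(k+1)} f − ℰ_{n k} f‖_{ℓ^p(B)}^p ≤ C ‖f‖_{ℓ^p(B)}^p`
(the `p`-th powers of `ℓ^p(B)` norms written out as sums over `ℤ`, in `ℝ≥0∞`). -/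
theorem stmt5 (p K : ℝ) (hp : 2 ≤ p) (hK : 0 < K) :
    ∃ C : ℝ, 0 < C ∧
      ∀ (B : Type*) [NormedAddCommGroup B] [NormedSpace ℝ B] [CompleteSpace B],
        (∀ ε ∈ Set.Ioc (0 : ℝ) 2, ∀ x y : B, ‖x‖ ≤ 1 → ‖y‖ ≤ 1 → ε ≤ ‖x - y‖ →
          ‖(1 / 2 : ℝ) • (x + y)‖ ≤ 1 - K * ε ^ p) →
        ∀ f : ℤ → B, Memℓp f (ENNReal.ofReal p) →
        ∀ n : ℕ → ℕ, StrictMono n →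
          ∑' k : ℕ, ∑' x : ℤ,
              (‖dyadicExp (n (k + 1)) f x - dyadicExp (n k) f x‖₊ : ℝ≥0∞) ^ p
            ≤ ENNReal.ofReal C * ∑' x : ℤ, (‖f x‖₊ : ℝ≥0∞) ^ p := by
  have hc := midpointConst_pos (p := p) hK
  refine ⟨(2 * midpointConst p K)⁻¹, by positivity, ?_⟩
  intro B _ _ _ hB f _ n hn
  have hB' : HasPowerConvexity B p K := hB
  have hsum := (ENNReal.tsum_le_of_add_le
    (A := fun k => ∑' x : ℤ, (‖dyadicExp (n k) f x‖₊ : ℝ≥0∞) ^ p) fun k =>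
      hB'.tsum_dyadicExp_add_le hp hK (hn k.lt_succ_self).le f).trans
    (tsum_dyadicExp_rpow_le (by linarith) (n 0) f)
  rw [ENNReal.tsum_mul_left] at hsum
  rw [ENNReal.ofReal_inv_of_pos (by positivity), mul_comm, ← div_eq_mul_inv,
    ENNReal.le_div_iff_mul_le (Or.inl (by simpa using hc)) (Or.inl ENNReal.ofReal_ne_top),
    mul_comm]
  exact hsum
end

section
/- Let p ≥ 2 and K > 0. There exists a constant C > 0, depending only on p and K, such that for every real Banach space B with modulus of uniform convexity η(ε) = K ε^p, every f ∈ ℓ^p(B), and every strictly increasing sequence (t_k)_{k∈ℕ} of positive integers, ∑_k ‖A_{t_{k+1}} f − A_{t_k} f‖_{ℓ^p(B)}^p ≤ C ‖f‖_{ℓ^p(B)}^p. -/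
open Finset ENNReal NNReal

/-- The shift ergodic averages on `ℤ`: `(A_n f)(x) = (1/n) ∑_{i<n} f (x + i)`. -/
noncomputable def shiftAvg {B : Type*} [AddCommGroup B] [Module ℝ B]
    (n : ℕ) (f : ℤ → B) (x : ℤ) : B :=
  (n : ℝ)⁻¹ • ∑ i ∈ Finset.range n, f (x + (i : ℤ))

theorem Real.rpow_add_rpow_half_le {p s : ℝ} (hp : 2 ≤ p) (hs0 : 0 ≤ s) (hs1 : s ≤ 1) :
    ((1 + s) / 2) ^ p + ((1 - s) / 2) ^ p ≤ (1 + s ^ p) / 2 := by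
  have hp2 : (1 : ℝ) ≤ p / 2 := by linarith
  have sq_rpow : ∀ a : ℝ, 0 ≤ a → a ^ p = (a ^ 2) ^ (p / 2) := fun a ha => by
    rw [← Real.rpow_natCast, ← Real.rpow_mul ha]; congr 1; push_cast; ring
  have hadd := Real.add_rpow_le_rpow_add (sq_nonneg ((1 + s) / 2)) (sq_nonneg ((1 - s) / 2)) hp2
  have hconv := (convexOn_rpow hp2).2 (Set.mem_Ici.2 (zero_le_one (α := ℝ)))
    (Set.mem_Ici.2 (sq_nonneg s)) (one_half_pos (α := ℝ)).le (one_half_pos (α := ℝ)).le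
    (add_halves 1)
  rw [sq_rpow _ (by linarith), sq_rpow _ (by linarith), sq_rpow s hs0]
  refine hadd.trans ?_
  simp only [smul_eq_mul, Real.one_rpow] at hconv
  rw [show ((1 + s) / 2) ^ 2 + ((1 - s) / 2) ^ 2 = 1 / 2 * 1 + 1 / 2 * s ^ 2 by ring]
  linarith

theorem Real.add_rpow_le_two_rpow_mul {p a b : ℝ} (hp : 1 ≤ p) (ha : 0 ≤ a) (hb : 0 ≤ b) :
    (a + b) ^ p ≤ 2 ^ (p - 1) * (a ^ p + b ^ p) := by
  have := NNReal.rpow_add_le_mul_rpow_add_rpow ⟨a, ha⟩ ⟨b, hb⟩ hp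
  exact_mod_cast this

section
variable {B : Type*} [NormedAddCommGroup B] [NormedSpace ℝ B]

/-- The two-point inequality expressing uniform convexity of power type `p`. -/
def TwoPoint (p c : ℝ) (B : Type*) [NormedAddCommGroup B] [NormedSpace ℝ B] : Prop :=
  ∀ x y : B, ‖(1 / 2 : ℝ) • (x + y)‖ ^ p + c * ‖x - y‖ ^ p ≤ (‖x‖ ^ p + ‖y‖ ^ p) / 2

theorem twoPoint_of_norm_eq_one {p K : ℝ} (hp : 2 ≤ p) (hK : 0 < K)
    (hB : ∀ ε ∈ Set.Ioc (0 : ℝ) 2, ∀ x y : B, ‖x‖ ≤ 1 → ‖y‖ ≤ 1 → ε ≤ ‖x - y‖ →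
          ‖(1 / 2 : ℝ) • (x + y)‖ ≤ 1 - K * ε ^ p)
    {x y : B} (hx : ‖x‖ = 1) (hy : ‖y‖ ≤ 1) :
    ‖(1 / 2 : ℝ) • (x + y)‖ ^ p + 2 ^ (1 - p) * min (2 ^ (1 - p) * K) (2 ^ (-p)) * ‖x - y‖ ^ p
      ≤ (1 + ‖y‖ ^ p) / 2 := by
  obtain ⟨s, hs⟩ : ∃ s, s = ‖y‖ := ⟨_, rfl⟩
  have hs0 : 0 ≤ s := hs ▸ norm_nonneg y
  have hs1 : s ≤ 1 := hs ▸ hy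
  obtain ⟨z, hz, hyz⟩ : ∃ z : B, ‖z‖ ≤ 1 ∧ y = s • z := by
    rcases hs0.eq_or_lt with h | h
    · exact ⟨0, by simp, by rw [smul_zero, ← norm_eq_zero, ← hs, ← h]⟩
    · refine ⟨s⁻¹ • y, ?_, by rw [smul_smul, mul_inv_cancel₀ h.ne', one_smul]⟩
      rw [norm_smul, ← hs, Real.norm_of_nonneg (inv_nonneg.2 hs0), inv_mul_cancel₀ h.ne']
  set a := ‖x - z‖ with ha
  have ha0 : 0 ≤ a := norm_nonneg _
  have hmid : ‖(1 / 2 : ℝ) • (x + z)‖ ≤ 1 - K * a ^ p := by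
    rcases ha0.eq_or_lt with h | h
    · rw [← h, Real.zero_rpow (by linarith), mul_zero, sub_zero, norm_smul]
      have := norm_add_le x z
      norm_num
      linarith
    · refine hB a ⟨h, ?_⟩ x z hx.le hz le_rfl
      have := norm_sub_le x z
      linarith
  have hap : 0 ≤ a ^ p := Real.rpow_nonneg ha0 p
  have hKa : 0 ≤ K * a ^ p := by positivity
  have hnorm : ‖(1 / 2 : ℝ) • (x + y)‖ ≤ (1 + s) / 2 - s * (K * a ^ p) := by
    have : (1 / 2 : ℝ) • (x + y) = s • ((1 / 2 : ℝ) • (x + z)) + ((1 - s) / 2) • x := by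
      rw [hyz]; module
    rw [this]
    refine (norm_add_le _ _).trans ?_
    rw [norm_smul s, norm_smul ((1 - s) / 2), hx, Real.norm_of_nonneg hs0,
      Real.norm_of_nonneg (by linarith)]
    nlinarith [mul_le_mul_of_nonneg_left hmid hs0]
  have hpow : ‖(1 / 2 : ℝ) • (x + y)‖ ^ p
      ≤ ((1 + s) / 2) ^ p - 2 ^ (1 - p) * (s * (K * a ^ p)) := by
    set A := (1 + s) / 2 with hA
    have hA2 : 1 / 2 ≤ A := by rw [hA]; linarith
    have hA0 : 0 < A := by linarith
    set b := s * (K * a ^ p) with hb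
    have hb0 : 0 ≤ b := by positivity
    have hbA : b ≤ A := by linarith [norm_nonneg ((1 / 2 : ℝ) • (x + y))]
    have h1 : (A - b) ^ p = A ^ p * (1 - b / A) ^ p := by
      rw [← Real.mul_rpow hA0.le (by rw [sub_nonneg, div_le_one hA0]; exact hbA)]
      congr 1; field_simp
    have h2 : (1 - b / A) ^ p ≤ 1 - b / A := by
      refine Real.rpow_le_self_of_le_one ?_ ?_ (by linarith)
      · rw [sub_nonneg, div_le_one hA0]; exact hbA
      · have : 0 ≤ b / A := by positivity
        linarith
    have h3 : (2 : ℝ) ^ (1 - p) ≤ A ^ p / A := by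
      rw [← Real.rpow_sub_one hA0.ne']
      calc (2 : ℝ) ^ (1 - p) = (1 / 2) ^ (p - 1) := by
            rw [one_div, Real.inv_rpow (by norm_num), ← Real.rpow_neg (by norm_num), neg_sub]
        _ ≤ _ := Real.rpow_le_rpow (by norm_num) hA2 (by linarith)
    calc _ ≤ (A - b) ^ p := Real.rpow_le_rpow (norm_nonneg _) hnorm (by linarith)
      _ ≤ A ^ p * (1 - b / A) := by
          rw [h1]; exact mul_le_mul_of_nonneg_left h2 (by positivity)
      _ = A ^ p - A ^ p / A * b := by field_simp
      _ ≤ _ := by gcongr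
  have hdist : ‖x - y‖ ^ p ≤ 2 ^ (p - 1) * (s * a ^ p + (1 - s) ^ p) := by
    have h1 : ‖x - y‖ ≤ s * a + (1 - s) := by
      have : x - y = s • (x - z) + (1 - s) • x := by rw [hyz]; module
      rw [this]
      refine (norm_add_le _ _).trans ?_
      rw [norm_smul, norm_smul, hx, Real.norm_of_nonneg hs0, Real.norm_of_nonneg (by linarith),
        mul_one]
    have h2 : (s * a) ^ p ≤ s * a ^ p := by
      rw [Real.mul_rpow hs0 ha0]
      exact mul_le_mul_of_nonneg_right (Real.rpow_le_self_of_le_one hs0 hs1 (by linarith)) hap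
    calc _ ≤ (s * a + (1 - s)) ^ p := Real.rpow_le_rpow (norm_nonneg _) h1 (by linarith)
      _ ≤ 2 ^ (p - 1) * ((s * a) ^ p + (1 - s) ^ p) :=
          Real.add_rpow_le_two_rpow_mul (by linarith) (by positivity) (by linarith)
      _ ≤ _ := by gcongr
  have hscal := Real.rpow_add_rpow_half_le hp hs0 hs1
  rw [Real.div_rpow (x := 1 - s) (by linarith) (by norm_num), div_eq_mul_inv ((1 - s) ^ p),
    ← Real.rpow_neg (by norm_num)] at hscal
  set m := min (2 ^ (1 - p) * K) ((2 : ℝ) ^ (-p)) with hm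
  have hm0 : 0 < m := by positivity
  have h1s : 0 ≤ (1 - s) ^ p := Real.rpow_nonneg (by linarith) p
  have hgain : 2 ^ (1 - p) * m * ‖x - y‖ ^ p ≤ m * (s * a ^ p + (1 - s) ^ p) := by
    have h2 : (2 : ℝ) ^ (1 - p) * 2 ^ (p - 1) = 1 := by
      rw [← Real.rpow_add (by norm_num)]; simp
    calc _ ≤ 2 ^ (1 - p) * m * (2 ^ (p - 1) * (s * a ^ p + (1 - s) ^ p)) := by gcongr
      _ = (2 ^ (1 - p) * 2 ^ (p - 1)) * (m * (s * a ^ p + (1 - s) ^ p)) := by ring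
      _ = _ := by rw [h2, one_mul]
  have e1 : m * (s * a ^ p) ≤ 2 ^ (1 - p) * K * (s * a ^ p) := by
    gcongr; exact min_le_left _ _
  have e2 : m * (1 - s) ^ p ≤ 2 ^ (-p) * (1 - s) ^ p := by
    gcongr; exact min_le_right _ _
  rw [← hs]
  nlinarith

theorem twoPoint_of_modulus {p K : ℝ} (hp : 2 ≤ p) (hK : 0 < K)
    (hB : ∀ ε ∈ Set.Ioc (0 : ℝ) 2, ∀ x y : B, ‖x‖ ≤ 1 → ‖y‖ ≤ 1 → ε ≤ ‖x - y‖ →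
          ‖(1 / 2 : ℝ) • (x + y)‖ ≤ 1 - K * ε ^ p) :
    TwoPoint p (2 ^ (1 - p) * min (2 ^ (1 - p) * K) (2 ^ (-p))) B := by
  have key : ∀ x y : B, ‖y‖ ≤ ‖x‖ → ‖(1 / 2 : ℝ) • (x + y)‖ ^ p +
      2 ^ (1 - p) * min (2 ^ (1 - p) * K) (2 ^ (-p)) * ‖x - y‖ ^ p
        ≤ (‖x‖ ^ p + ‖y‖ ^ p) / 2 := by
    intro x y hxy
    have hp0 : p ≠ 0 := by linarith
    rcases (norm_nonneg x).eq_or_lt with h | h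
    · have hx : x = 0 := norm_eq_zero.1 h.symm
      have hy : y = 0 := norm_le_zero_iff.1 (hxy.trans h.symm.le)
      simp [hx, hy, Real.zero_rpow hp0]
    · set r := ‖x‖ with hr
      have scale : ∀ v : B, ‖v‖ ^ p = r ^ p * ‖r⁻¹ • v‖ ^ p := fun v => by
        rw [← Real.mul_rpow h.le (norm_nonneg _), norm_smul, norm_inv, Real.norm_of_nonneg h.le,
          mul_inv_cancel_left₀ h.ne']
      have := twoPoint_of_norm_eq_one hp hK hB (x := r⁻¹ • x) (y := r⁻¹ • y)
        (by rw [norm_smul, norm_inv, Real.norm_of_nonneg h.le, ← hr, inv_mul_cancel₀ h.ne'])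
        (by rw [norm_smul, norm_inv, Real.norm_of_nonneg h.le, inv_mul_le_one₀ h]; exact hxy)
      rw [← smul_add, ← smul_sub, smul_comm] at this
      rw [scale (_ • _), scale (x - y), scale y]
      have := mul_le_mul_of_nonneg_left this (Real.rpow_nonneg h.le p)
      linarith
  intro x y
  rcases le_total ‖y‖ ‖x‖ with h | h
  · exact key x y h
  · have := key y x h
    rw [add_comm y x, norm_sub_rev] at this
    linarith
end

section
variable {X : Type*} [NormedAddCommGroup X] [NormedSpace ℝ X]

/-- The ergodic sums `∑_{i<n} T^i x`. -/
def ergSum (T : X →ₗᵢ[ℝ] X) (n : ℕ) (x : X) : X := ∑ i ∈ range n, (T ^ i) x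

/-- The ergodic averages `(1/n) ∑_{i<n} T^i x`. -/
noncomputable def ergAvg (T : X →ₗᵢ[ℝ] X) (n : ℕ) (x : X) : X := (n : ℝ)⁻¹ • ergSum T n x

variable (T : X →ₗᵢ[ℝ] X) (x : X)

theorem ergSum_add (m n : ℕ) : ergSum T (m + n) x = ergSum T m x + (T ^ m) (ergSum T n x) := by
  simp only [ergSum, sum_range_add, map_sum, pow_add, LinearIsometry.coe_mul, Function.comp_apply]

theorem smul_ergAvg {n : ℕ} (hn : 0 < n) : (n : ℝ) • ergAvg T n x = ergSum T n x := by
  rw [ergAvg, smul_smul, mul_inv_cancel₀ (by positivity), one_smul]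

/-- The jump between consecutive dyadic averages. -/
noncomputable def dyadicJump (l : ℕ) : ℝ := ‖ergAvg T (2 ^ l) x - ergAvg T (2 ^ (l + 1)) x‖

theorem dyadicJump_nonneg (l : ℕ) : 0 ≤ dyadicJump T x l := norm_nonneg _

theorem ergAvg_two_pow_succ (n : ℕ) : ergAvg T (2 ^ (n + 1)) x =
    (1 / 2 : ℝ) • (ergAvg T (2 ^ n) x + (T ^ 2 ^ n) (ergAvg T (2 ^ n) x)) := by
  simp only [ergAvg, pow_succ, mul_two, ergSum_add, map_smul]
  push_cast
  rw [← smul_add, smul_smul]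
  congr 1
  field_simp
  norm_num

theorem norm_ergSum_sub_le (n : ℕ) : ∀ s ≤ 2 ^ n,
    ‖ergSum T s x - (s : ℝ) • ergAvg T (2 ^ n) x‖
      ≤ ∑ l ∈ range n, min (2 ^ l) (s : ℝ) * dyadicJump T x l := by
  induction n with
  | zero =>
    intro s hs
    have : s = 0 ∨ s = 1 := by rw [pow_zero] at hs; omega
    rcases this with rfl | rfl <;> simp [ergSum, ergAvg]
  | succ n ih =>
    intro s hs
    rw [sum_range_succ]
    have hu : 0 ≤ dyadicJump T x n := dyadicJump_nonneg T x n
    set a := ergAvg T (2 ^ n) x with ha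
    set b := ergAvg T (2 ^ (n + 1)) x with hb
    have hab : ‖a - b‖ = dyadicJump T x n := rfl
    rcases le_total s (2 ^ n) with h | h
    · have h' : (s : ℝ) ≤ 2 ^ n := by exact_mod_cast h
      rw [min_eq_right h']
      calc ‖ergSum T s x - (s : ℝ) • b‖
          = ‖(ergSum T s x - (s : ℝ) • a) + (s : ℝ) • (a - b)‖ := by congr 1; module
        _ ≤ ‖ergSum T s x - (s : ℝ) • a‖ + ‖(s : ℝ) • (a - b)‖ := norm_add_le _ _
        _ ≤ _ := by
          rw [norm_smul, hab, Real.norm_of_nonneg (by positivity)]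
          exact add_le_add_left (ih s h) _
    · obtain ⟨r, rfl⟩ := Nat.exists_eq_add_of_le h
      have hr : r ≤ 2 ^ n := by rw [pow_succ] at hs; omega
      have hr' : (r : ℝ) ≤ 2 ^ n := by exact_mod_cast hr
      have hTa : (T ^ 2 ^ n) a = (2 : ℝ) • b - a := by
        rw [hb, ergAvg_two_pow_succ, smul_smul]; norm_num [← ha]
      have hsum : ergSum T (2 ^ n) x = (2 : ℝ) ^ n • a := by
        have := smul_ergAvg T x (n := 2 ^ n) (by positivity)
        push_cast at this; exact this.symm
      have hdec : ergSum T (2 ^ n + r) x - ((2 ^ n + r : ℕ) : ℝ) • b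
          = (T ^ 2 ^ n) (ergSum T r x - (r : ℝ) • a) + ((2 : ℝ) ^ n - r) • (a - b) := by
        rw [ergSum_add, map_sub, map_smul, hTa, hsum]
        push_cast
        module
      rw [hdec]
      refine (norm_add_le _ _).trans ?_
      rw [LinearIsometry.norm_map, norm_smul, hab, Real.norm_of_nonneg (by linarith)]
      refine add_le_add ((ih r hr).trans ?_) ?_
      · refine sum_le_sum fun l _ => ?_
        have : 0 ≤ dyadicJump T x l := dyadicJump_nonneg T x l
        gcongr
        omega
      · gcongr
        rw [min_eq_left (by push_cast; linarith)]
        have : (0 : ℝ) ≤ r := by positivity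
        linarith

/-- Exponentially smoothed dyadic jumps, with ratio `1 / √2`. -/
noncomputable def smoothJump (n : ℕ) : ℝ :=
  (√2 ^ n)⁻¹ * ∑ l ∈ range (n + 1), √2 ^ l * dyadicJump T x l

theorem sum_sqrt_two_pow_mul_dyadicJump (n : ℕ) :
    ∑ l ∈ range (n + 1), √2 ^ l * dyadicJump T x l = √2 ^ n * smoothJump T x n := by
  rw [smoothJump, mul_inv_cancel_left₀ (by positivity)]

theorem sqrt_two_pow_sq (n : ℕ) : √2 ^ n * √2 ^ n = (2 : ℝ) ^ n := by
  rw [← mul_pow, Real.mul_self_sqrt (by norm_num)]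

theorem sqrt_two_pow_eq (n : ℕ) : √2 ^ n = √((2 : ℝ) ^ n) := by
  rw [← sqrt_two_pow_sq, Real.sqrt_mul_self (by positivity)]

theorem smoothJump_nonneg (n : ℕ) : 0 ≤ smoothJump T x n :=
  mul_nonneg (by positivity) (sum_nonneg fun l _ => mul_nonneg (by positivity) (dyadicJump_nonneg T x l))

theorem sum_two_pow_mul_dyadicJump_le (n : ℕ) :
    ∑ l ∈ range (n + 1), 2 ^ l * dyadicJump T x l ≤ 2 ^ n * smoothJump T x n := by
  rw [← sqrt_two_pow_sq, mul_assoc, ← sum_sqrt_two_pow_mul_dyadicJump, mul_sum]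
  refine sum_le_sum fun l hl => ?_
  have hu : 0 ≤ dyadicJump T x l := dyadicJump_nonneg T x l
  rw [← mul_assoc, ← sqrt_two_pow_sq]
  have : √2 ^ l ≤ √2 ^ n := pow_le_pow_right₀ (Real.one_le_sqrt.2 (by norm_num))
    (Nat.lt_succ_iff.1 (mem_range.1 hl))
  gcongr

theorem norm_ergSum_sub_le_smoothJump {m n s : ℕ} (hm : m ≤ n + 1) (hs : s ≤ 2 ^ m) :
    ‖ergSum T s x - (s : ℝ) • ergAvg T (2 ^ m) x‖ ≤ 2 ^ n * smoothJump T x n := by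
  refine (norm_ergSum_sub_le T x m s hs).trans ((sum_le_sum fun l _ =>
    mul_le_mul_of_nonneg_right (min_le_left _ _) (dyadicJump_nonneg T x l)).trans
    (le_trans (sum_le_sum_of_subset_of_nonneg (range_mono hm) fun l _ _ => ?_)
      (sum_two_pow_mul_dyadicJump_le T x n)))
  exact mul_nonneg (by positivity) (dyadicJump_nonneg T x l)

theorem norm_pow_ergAvg_sub_le (n s : ℕ) (hs : s ≤ 2 ^ n) :
    ‖(T ^ s) (ergAvg T (2 ^ n) x) - ergAvg T (2 ^ n) x‖ ≤ 3 * smoothJump T x n := by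
  set a := ergAvg T (2 ^ n) x with ha
  set b := ergAvg T (2 ^ (n + 1)) x with hb
  have hsum : ergSum T (2 ^ n) x = (2 : ℝ) ^ n • a := by
    have := smul_ergAvg T x (n := 2 ^ n) (by positivity)
    push_cast at this; exact this.symm
  have h2 : 2 ^ n ≤ 2 ^ (n + 1) := Nat.pow_le_pow_right (by norm_num) (by omega)
  have b1 := norm_ergSum_sub_le_smoothJump T x le_rfl (n := n) (s := s + 2 ^ n) (by rw [pow_succ]; omega)
  have b2 := norm_ergSum_sub_le_smoothJump T x le_rfl (n := n) (s := s) (by omega)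
  have b3 := norm_ergSum_sub_le_smoothJump T x le_rfl (n := n) h2
  have hdec : (2 : ℝ) ^ n • ((T ^ s) a - a) =
      (ergSum T (s + 2 ^ n) x - ((s + 2 ^ n : ℕ) : ℝ) • b) - (ergSum T s x - (s : ℝ) • b)
        - (ergSum T (2 ^ n) x - ((2 ^ n : ℕ) : ℝ) • b) := by
    rw [ergSum_add, hsum, map_smul]
    push_cast
    module
  have h2n : (0 : ℝ) < 2 ^ n := by positivity
  refine le_of_mul_le_mul_left ?_ h2n
  calc (2 : ℝ) ^ n * ‖(T ^ s) a - a‖ = ‖(2 : ℝ) ^ n • ((T ^ s) a - a)‖ := by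
        rw [norm_smul, Real.norm_of_nonneg h2n.le]
    _ ≤ _ := by
        rw [hdec]
        refine (norm_sub_le _ _).trans ?_
        have := norm_sub_le (ergSum T (s + 2 ^ n) x - ((s + 2 ^ n : ℕ) : ℝ) • b)
          (ergSum T s x - (s : ℝ) • b)
        linarith

/-- Jumps of the averages inside a dyadic block are Hölder continuous of exponent `1 / 2`. -/
theorem norm_ergAvg_sub_le (n t d : ℕ) (ht : 2 ^ n ≤ t) (htd : t + d ≤ 2 ^ (n + 1)) :
    ‖ergAvg T (t + d) x - ergAvg T t x‖
      ≤ 9 * (√(d / 2 ^ n) * smoothJump T x (n + 1)) := by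
  set a := ergAvg T (2 ^ (n + 1)) x with ha
  set g := smoothJump T x (n + 1) with hg
  have hg0 : 0 ≤ g := smoothJump_nonneg T x _
  have h2n : (0 : ℝ) < 2 ^ n := by positivity
  have ht' : (2 : ℝ) ^ n ≤ t := by exact_mod_cast ht
  have ht0 : (0 : ℝ) < t := h2n.trans_le ht'
  have htn : 0 < t := by exact_mod_cast ht0
  have hd : (d : ℝ) ≤ 2 ^ n := by
    have : d ≤ 2 ^ n := by rw [pow_succ] at htd; omega
    exact_mod_cast this
  have hd0 : (0 : ℝ) ≤ d := by positivity
  have b1 : ‖ergSum T d x - (d : ℝ) • a‖ ≤ √d * (√2 ^ (n + 1) * g) := by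
    rw [hg, ← sum_sqrt_two_pow_mul_dyadicJump, mul_sum]
    refine (norm_ergSum_sub_le T x (n + 1) d (by omega)).trans
      (le_trans (sum_le_sum (g := fun l => √d * (√2 ^ l * dyadicJump T x l)) fun l _ => ?_)
      (sum_le_sum_of_subset_of_nonneg (range_mono (by omega)) fun l _ _ => ?_))
    · rw [← mul_assoc]
      refine mul_le_mul_of_nonneg_right ?_ (dyadicJump_nonneg T x l)
      rw [sqrt_two_pow_eq]
      rcases le_total ((2 : ℝ) ^ l) d with h | h
      · exact (min_le_left _ _).trans ((Real.mul_self_sqrt (by positivity)).symm.le.trans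
          (mul_le_mul_of_nonneg_right (Real.sqrt_le_sqrt h) (by positivity)))
      · exact (min_le_right _ _).trans ((Real.mul_self_sqrt hd0).symm.le.trans
          (mul_le_mul_of_nonneg_left (Real.sqrt_le_sqrt h) (by positivity)))
    · have : 0 ≤ dyadicJump T x l := dyadicJump_nonneg T x l
      positivity
  have b2 : ‖(T ^ t) a - a‖ ≤ 3 * g := norm_pow_ergAvg_sub_le T x (n + 1) t (by omega)
  have b3 : ‖ergAvg T t x - a‖ ≤ 2 * g := by
    have h := norm_ergSum_sub_le_smoothJump T x (Nat.le_succ (n + 1)) (s := t) (by omega)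
    rw [← smul_ergAvg T x htn, ← smul_sub, norm_smul, Real.norm_of_nonneg ht0.le] at h
    have h' : (2 : ℝ) ^ n * ‖ergAvg T t x - a‖ ≤ 2 ^ n * (2 * g) :=
      (mul_le_mul_of_nonneg_right ht' (norm_nonneg _)).trans (h.trans_eq (by rw [pow_succ]; ring))
    exact le_of_mul_le_mul_left h' h2n
  have hdec : ((t + d : ℕ) : ℝ) • (ergAvg T (t + d) x - ergAvg T t x) =
      (T ^ t) (ergSum T d x - (d : ℝ) • a) + (d : ℝ) • ((T ^ t) a - a)
        - (d : ℝ) • (ergAvg T t x - a) := by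
    rw [smul_sub, smul_ergAvg T x (by omega), ergSum_add, ← smul_ergAvg T x htn, map_sub, map_smul]
    push_cast
    module
  have hnorm : ((t + d : ℕ) : ℝ) * ‖ergAvg T (t + d) x - ergAvg T t x‖
      ≤ √d * (√2 ^ (n + 1) * g) + d * (3 * g) + d * (2 * g) := by
    rw [← Real.norm_of_nonneg (Nat.cast_nonneg (t + d)), ← norm_smul, hdec]
    refine (norm_sub_le _ _).trans (add_le_add ((norm_add_le _ _).trans (add_le_add ?_ ?_)) ?_)
    · rwa [LinearIsometry.norm_map]
    · rw [norm_smul, Real.norm_of_nonneg hd0]; gcongr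
    · rw [norm_smul, Real.norm_of_nonneg hd0]; gcongr
  have hq : (0 : ℝ) < √2 ^ n := by positivity
  have hd2 : (d : ℝ) ≤ √d * √2 ^ n := by
    rw [sqrt_two_pow_eq]
    exact (Real.mul_self_sqrt hd0).symm.le.trans
      (mul_le_mul_of_nonneg_left (Real.sqrt_le_sqrt hd) (by positivity))
  have hsqrt : √2 ≤ 2 := Real.sqrt_le_left (by norm_num) |>.2 (by norm_num)
  rw [Real.sqrt_div hd0, ← sqrt_two_pow_eq]
  refine le_of_mul_le_mul_left ?_ h2n
  calc (2 : ℝ) ^ n * ‖ergAvg T (t + d) x - ergAvg T t x‖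
      ≤ ((t + d : ℕ) : ℝ) * ‖ergAvg T (t + d) x - ergAvg T t x‖ := by
        gcongr; push_cast; linarith
    _ ≤ √d * (√2 ^ (n + 1) * g) + d * (3 * g) + d * (2 * g) := hnorm
    _ ≤ √d * ((√2 ^ n * 2) * g) + √d * √2 ^ n * (3 * g) + √d * √2 ^ n * (2 * g) := by
        rw [pow_succ]; gcongr
    _ = 7 * (√d * √2 ^ n * g) := by ring
    _ ≤ 9 * (√d * √2 ^ n * g) := by gcongr; norm_num
    _ = 2 ^ n * (9 * (√d / √2 ^ n * g)) := by rw [← sqrt_two_pow_sq]; field_simp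
end

section
variable {X : Type*} [NormedAddCommGroup X] [NormedSpace ℝ X] {p c : ℝ}
variable (T : X →ₗᵢ[ℝ] X) (x : X)

theorem TwoPoint.dyadicJump_rpow_le (h : TwoPoint p c X) (hp : 0 ≤ p) (hc : 0 < c) (n : ℕ) :
    c * dyadicJump T x n ^ p
      ≤ ‖ergAvg T (2 ^ n) x‖ ^ p - ‖ergAvg T (2 ^ (n + 1)) x‖ ^ p := by
  have h1 := h (ergAvg T (2 ^ n) x) ((T ^ 2 ^ n) (ergAvg T (2 ^ n) x))
  rw [← ergAvg_two_pow_succ, LinearIsometry.norm_map] at h1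
  have h2 : dyadicJump T x n ≤ ‖ergAvg T (2 ^ n) x - (T ^ 2 ^ n) (ergAvg T (2 ^ n) x)‖ := by
    have : ergAvg T (2 ^ n) x - ergAvg T (2 ^ (n + 1)) x
        = (1 / 2 : ℝ) • (ergAvg T (2 ^ n) x - (T ^ 2 ^ n) (ergAvg T (2 ^ n) x)) := by
      rw [ergAvg_two_pow_succ]; module
    rw [dyadicJump, this, norm_smul]
    have := norm_nonneg (ergAvg T (2 ^ n) x - (T ^ 2 ^ n) (ergAvg T (2 ^ n) x))
    norm_num
    linarith
  have h3 := mul_le_mul_of_nonneg_left (Real.rpow_le_rpow (dyadicJump_nonneg T x n) h2 hp) hc.le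
  linarith

theorem TwoPoint.antitone_norm_ergAvg (h : TwoPoint p c X) (hp : 0 ≤ p) (hc : 0 < c) :
    Antitone fun n => ‖ergAvg T (2 ^ n) x‖ ^ p :=
  antitone_nat_of_succ_le fun n => by
    have := h.dyadicJump_rpow_le T x hp hc n
    have : 0 ≤ c * dyadicJump T x n ^ p :=
      mul_nonneg hc.le (Real.rpow_nonneg (dyadicJump_nonneg T x n) p)
    linarith

theorem norm_ergAvg_two_pow_zero : ‖ergAvg T (2 ^ 0) x‖ = ‖x‖ := by simp [ergAvg, ergSum]

theorem TwoPoint.sum_dyadicJump_rpow_le (h : TwoPoint p c X) (hp : 0 ≤ p) (hc : 0 < c) (n : ℕ) :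
    ∑ l ∈ range n, dyadicJump T x l ^ p ≤ c⁻¹ * ‖x‖ ^ p := by
  rw [le_inv_mul_iff₀ hc, mul_sum]
  calc _ ≤ ∑ l ∈ range n, (‖ergAvg T (2 ^ l) x‖ ^ p - ‖ergAvg T (2 ^ (l + 1)) x‖ ^ p) :=
        sum_le_sum fun l _ => h.dyadicJump_rpow_le T x hp hc l
    _ = ‖x‖ ^ p - ‖ergAvg T (2 ^ n) x‖ ^ p := by rw [sum_range_sub', norm_ergAvg_two_pow_zero]
    _ ≤ _ := sub_le_self _ (Real.rpow_nonneg (norm_nonneg _) p)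

theorem smoothJump_succ (n : ℕ) : smoothJump T x (n + 1)
    = (√2)⁻¹ * smoothJump T x n + dyadicJump T x (n + 1) := by
  rw [smoothJump, sum_range_succ, sum_sqrt_two_pow_mul_dyadicJump, pow_succ]
  field_simp

theorem inv_sqrt_two_lt_one : (√2)⁻¹ < 1 :=
  inv_lt_one_of_one_lt₀ (Real.lt_sqrt (by norm_num) |>.2 (by norm_num))

theorem Real.mul_add_rpow_le {p r a b : ℝ} (hp : 1 ≤ p) (hr0 : 0 ≤ r) (hr1 : r < 1) (ha : 0 ≤ a)
    (hb : 0 ≤ b) : (r * a + b) ^ p ≤ r * a ^ p + (1 - r) ^ (1 - p) * b ^ p := by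
  have h1 : 0 < 1 - r := sub_pos.2 hr1
  have h := (convexOn_rpow hp).2 (Set.mem_Ici.2 ha) (Set.mem_Ici.2 (div_nonneg hb h1.le)) hr0 h1.le
    (by ring)
  simp only [smul_eq_mul] at h
  rw [mul_div_cancel₀ _ h1.ne', Real.div_rpow hb h1.le] at h
  rw [Real.rpow_sub h1, Real.rpow_one]
  exact h.trans_eq (by ring)

theorem TwoPoint.sum_smoothJump_rpow_le (h : TwoPoint p c X) (hp : 1 ≤ p) (hc : 0 < c) (n : ℕ) :
    ∑ l ∈ range n, smoothJump T x l ^ p ≤ (1 - (√2)⁻¹) ^ (-p) * c⁻¹ * ‖x‖ ^ p := by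
  set r := (√2)⁻¹ with hr
  have hr1 : 0 < 1 - r := sub_pos.2 inv_sqrt_two_lt_one
  have hr0 : 0 ≤ r := by positivity
  have hg : ∀ l, 0 ≤ smoothJump T x l ^ p := fun l => Real.rpow_nonneg (smoothJump_nonneg T x l) p
  have hrec : ∀ n, ∑ l ∈ range (n + 1), smoothJump T x l ^ p
      ≤ r * ∑ l ∈ range n, smoothJump T x l ^ p
        + (1 - r) ^ (1 - p) * ∑ l ∈ range (n + 1), dyadicJump T x l ^ p := by
    intro n
    induction n with
    | zero =>
      have h1 : 1 ≤ (1 - r) ^ (1 - p) :=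
        Real.one_le_rpow_of_pos_of_le_one_of_nonpos hr1 (by linarith) (by linarith)
      have : 0 ≤ dyadicJump T x 0 ^ p := Real.rpow_nonneg (dyadicJump_nonneg T x 0) p
      simpa [smoothJump] using le_mul_of_one_le_left this h1
    | succ n ih =>
      rw [sum_range_succ, sum_range_succ _ n, sum_range_succ _ (n + 1)]
      have := Real.mul_add_rpow_le hp hr0 inv_sqrt_two_lt_one (smoothJump_nonneg T x n)
        (dyadicJump_nonneg T x (n + 1))
      rw [smoothJump_succ]
      rw [sum_range_succ] at ih
      linarith
  have hmono : ∑ l ∈ range n, smoothJump T x l ^ p ≤ ∑ l ∈ range (n + 1), smoothJump T x l ^ p :=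
    sum_le_sum_of_subset_of_nonneg (range_mono (by omega)) fun l _ _ => hg l
  have hu := mul_le_mul_of_nonneg_left (h.sum_dyadicJump_rpow_le T x (by linarith) hc (n + 1))
    (Real.rpow_nonneg hr1.le (1 - p))
  have hfin : (1 - r) * ∑ l ∈ range n, smoothJump T x l ^ p
      ≤ (1 - r) ^ (1 - p) * (c⁻¹ * ‖x‖ ^ p) := by linarith [hrec n]
  rw [sub_eq_add_neg (1 : ℝ) p, Real.rpow_add hr1, Real.rpow_one, mul_assoc] at hfin
  have := le_of_mul_le_mul_left hfin hr1
  rwa [mul_assoc]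

theorem ergSum_mul (m k : ℕ) :
    ergSum T (m * k) x = ∑ i ∈ range k, (T ^ (m * i)) (ergSum T m x) := by
  induction k with
  | zero => simp [ergSum]
  | succ k ih => rw [Nat.mul_succ, ergSum_add, ih, sum_range_succ]

theorem ergAvg_mul (m k : ℕ) :
    ergAvg T (m * k) x = (k : ℝ)⁻¹ • ∑ i ∈ range k, (T ^ (m * i)) (ergAvg T m x) := by
  simp only [ergAvg, ergSum_mul, map_smul, ← smul_sum, smul_smul]
  congr 1
  push_cast
  rw [mul_inv, mul_comm]

theorem exists_norm_ergAvg_mul_le (m : ℕ) {k : ℕ} (hk : 0 < k) : ∃ i < k,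
    ‖ergAvg T (m * k) x‖
      ≤ ‖(1 / 2 : ℝ) • ((T ^ (m * i)) (ergAvg T m x) + ergAvg T (m * k) x)‖ := by
  by_contra! hcon
  set z := ergAvg T (m * k) x with hz
  have hk' : (0 : ℝ) < k := by positivity
  have hsum : ∑ i ∈ range k, (1 / 2 : ℝ) • ((T ^ (m * i)) (ergAvg T m x) + z) = (k : ℝ) • z := by
    have : ∑ i ∈ range k, (T ^ (m * i)) (ergAvg T m x) = (k : ℝ) • z := by
      rw [hz, ergAvg_mul, smul_smul, mul_inv_cancel₀ hk'.ne', one_smul]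
    rw [← smul_sum, sum_add_distrib, this, sum_const, card_range, ← Nat.cast_smul_eq_nsmul ℝ]
    module
  have hlt : ∑ i ∈ range k, ‖(1 / 2 : ℝ) • ((T ^ (m * i)) (ergAvg T m x) + z)‖
      < ∑ i ∈ range k, ‖z‖ :=
    sum_lt_sum_of_nonempty ⟨0, mem_range.2 hk⟩ fun i hi => hcon i (mem_range.1 hi)
  have hle := norm_sum_le (range k) fun i => (1 / 2 : ℝ) • ((T ^ (m * i)) (ergAvg T m x) + z)
  rw [hsum, norm_smul, Real.norm_of_nonneg hk'.le] at hle
  rw [sum_const, card_range, nsmul_eq_mul] at hlt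
  linarith

theorem TwoPoint.norm_ergAvg_two_pow_sub_le (h : TwoPoint p c X) (hp : 1 ≤ p) (hc : 0 < c)
    {a b : ℕ} (hab : a ≤ b) :
    ‖ergAvg T (2 ^ a) x - ergAvg T (2 ^ b) x‖ ^ p
      ≤ 2 ^ (p - 1) * (c⁻¹ * (‖ergAvg T (2 ^ a) x‖ ^ p - ‖ergAvg T (2 ^ b) x‖ ^ p)
        + 3 ^ p * smoothJump T x b ^ p) := by
  obtain ⟨d, rfl⟩ := Nat.exists_eq_add_of_le hab
  obtain ⟨i, hi, hle⟩ := exists_norm_ergAvg_mul_le T x (2 ^ a) (k := 2 ^ d) (by positivity)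
  rw [← pow_add] at hle
  have hs : 2 ^ a * i ≤ 2 ^ (a + d) := by rw [pow_add]; gcongr
  set y := ergAvg T (2 ^ a) x
  set z := ergAvg T (2 ^ (a + d)) x
  set g := smoothJump T x (a + d)
  set S := T ^ (2 ^ a * i)
  have hg0 : 0 ≤ g := smoothJump_nonneg T x _
  have h1 := h (S y) z
  rw [LinearIsometry.norm_map] at h1
  have h2 := Real.rpow_le_rpow (norm_nonneg _) hle (by linarith : 0 ≤ p)
  have hΦ : ‖z‖ ^ p ≤ ‖y‖ ^ p :=
    h.antitone_norm_ergAvg T x (by linarith) hc hab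
  have h3 : ‖S y - z‖ ^ p ≤ c⁻¹ * (‖y‖ ^ p - ‖z‖ ^ p) := by
    rw [le_inv_mul_iff₀ hc]; linarith
  have h4 : ‖y - z‖ ≤ ‖S y - z‖ + 3 * g := by
    have e : ‖y - z‖ = ‖(S y - z) - (S z - z)‖ := by
      rw [sub_sub_sub_cancel_right, ← map_sub, LinearIsometry.norm_map]
    rw [e]
    exact (norm_sub_le _ _).trans
      (add_le_add_right (norm_pow_ergAvg_sub_le T x (a + d) (2 ^ a * i) hs) _)
  calc ‖y - z‖ ^ p ≤ (‖S y - z‖ + 3 * g) ^ p :=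
        Real.rpow_le_rpow (norm_nonneg _) h4 (by linarith)
    _ ≤ 2 ^ (p - 1) * (‖S y - z‖ ^ p + (3 * g) ^ p) :=
        Real.add_rpow_le_two_rpow_mul hp (norm_nonneg _) (by positivity)
    _ ≤ _ := by
        rw [Real.mul_rpow (by norm_num) hg0]
        gcongr

theorem norm_ergAvg_sub_rpow_le (hp : 2 ≤ p) {n t t' : ℕ} (ht : 2 ^ n ≤ t) (htt : t ≤ t')
    (ht' : t' ≤ 2 ^ (n + 1)) :
    ‖ergAvg T t' x - ergAvg T t x‖ ^ p
      ≤ 9 ^ p * ((t' / 2 ^ n - t / 2 ^ n) * smoothJump T x (n + 1) ^ p) := by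
  obtain ⟨d, rfl⟩ := Nat.exists_eq_add_of_le htt
  have hg0 := smoothJump_nonneg T x (n + 1)
  have hd : (d : ℝ) / 2 ^ n ≤ 1 := by
    rw [div_le_one (by positivity)]
    have : d ≤ 2 ^ n := by rw [pow_succ] at ht'; omega
    exact_mod_cast this
  have hd0 : (0 : ℝ) ≤ d / 2 ^ n := by positivity
  refine (Real.rpow_le_rpow (norm_nonneg _) (norm_ergAvg_sub_le T x n t d ht ht')
    (by linarith)).trans ?_
  rw [Real.mul_rpow (by norm_num) (by positivity), Real.mul_rpow (by positivity) hg0]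
  gcongr
  calc √(d / 2 ^ n) ^ p = (d / 2 ^ n : ℝ) ^ (p / 2) := by
        rw [Real.sqrt_eq_rpow, ← Real.rpow_mul hd0]; congr 1; ring
    _ ≤ d / 2 ^ n := Real.rpow_le_self_of_le_one hd0 hd (by linarith)
    _ = _ := by push_cast; ring
end

/-- The piecewise linear primitive of `γ` over the dyadic blocks `[2 ^ n, 2 ^ (n + 1)]`, each of
which has mass `γ n`. -/
noncomputable def dyadicPrimitive (γ : ℕ → ℝ) (t : ℕ) : ℝ :=
  ∑ j ∈ range (Nat.log 2 t), γ j + (t / 2 ^ Nat.log 2 t - 1) * γ (Nat.log 2 t)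

theorem dyadicPrimitive_eq (γ : ℕ → ℝ) {n t : ℕ} (h1 : 2 ^ n ≤ t) (h2 : t ≤ 2 ^ (n + 1)) :
    dyadicPrimitive γ t = ∑ j ∈ range n, γ j + (t / 2 ^ n - 1) * γ n := by
  rcases h2.eq_or_lt with rfl | h
  · rw [dyadicPrimitive, Nat.log_pow (by norm_num), sum_range_succ]
    push_cast
    rw [pow_succ]
    field_simp
    ring
  · rw [dyadicPrimitive, Nat.log_eq_of_pow_le_of_lt_pow h1 h]

theorem dyadicPrimitive_mem_Icc {γ : ℕ → ℝ} (hγ : ∀ n, 0 ≤ γ n) {t : ℕ} (ht : 0 < t) :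
    dyadicPrimitive γ t ∈ Set.Icc (∑ j ∈ range (Nat.log 2 t), γ j)
      (∑ j ∈ range (Nat.log 2 t + 1), γ j) := by
  have h1 : (2 : ℝ) ^ Nat.log 2 t ≤ t := by exact_mod_cast Nat.pow_log_le_self 2 ht.ne'
  have h2 : (t : ℝ) ≤ 2 ^ (Nat.log 2 t + 1) := by
    exact_mod_cast (Nat.lt_pow_succ_log_self (by norm_num) t).le
  have h3 : (0 : ℝ) ≤ t / 2 ^ Nat.log 2 t - 1 := by
    rw [sub_nonneg, one_le_div (by positivity)]; exact h1
  have h4 : (t : ℝ) / 2 ^ Nat.log 2 t - 1 ≤ 1 := by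
    rw [sub_le_iff_le_add, div_le_iff₀ (by positivity), ← two_mul, mul_one, mul_comm, ← pow_succ]
    exact h2
  rw [dyadicPrimitive, sum_range_succ]
  exact ⟨le_add_of_nonneg_right (mul_nonneg h3 (hγ _)),
    add_le_add_right (mul_le_of_le_one_left (hγ _) h4) _⟩

section
variable {X : Type*} [NormedAddCommGroup X] [NormedSpace ℝ X] {p c : ℝ}
variable (T : X →ₗᵢ[ℝ] X) (x : X)

/-- A bounded function of `t` whose increments dominate the `p`-th powers of the jumps of the
ergodic averages. -/
noncomputable def jumpPotential (p c : ℝ) (t : ℕ) : ℝ :=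
  2 ^ (p - 1) * 2 ^ (p - 1) * (9 ^ p * dyadicPrimitive (fun n => smoothJump T x (n + 1) ^ p) t +
    2 ^ (p - 1) * (3 ^ p * ∑ j ∈ range (Nat.log 2 t + 1), smoothJump T x j ^ p
      - c⁻¹ * ‖ergAvg T (2 ^ Nat.log 2 t) x‖ ^ p))

theorem TwoPoint.jump_le_potential_sub (h : TwoPoint p c X) (hp : 2 ≤ p) (hc : 0 < c) {t t' : ℕ}
    (ht : 0 < t) (htt : t ≤ t') :
    ‖ergAvg T t' x - ergAvg T t x‖ ^ p
      ≤ jumpPotential T x p c t' - jumpPotential T x p c t := by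
  have hg : ∀ l, 0 ≤ smoothJump T x l ^ p := fun l => Real.rpow_nonneg (smoothJump_nonneg T x l) p
  have hQ : (1 : ℝ) ≤ 2 ^ (p - 1) := Real.one_le_rpow (by norm_num) (by linarith)
  have h1 := Nat.pow_log_le_self 2 ht.ne'
  have h2 := (Nat.lt_pow_succ_log_self (b := 2) (by norm_num) t).le
  have h1' := Nat.pow_log_le_self 2 (ht.trans_le htt).ne'
  have h2' := (Nat.lt_pow_succ_log_self (b := 2) (by norm_num) t').le
  have hlog := Nat.log_mono_right (b := 2) htt
  unfold jumpPotential
  set n := Nat.log 2 t with hn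
  set m := Nat.log 2 t' with hm
  set γ : ℕ → ℝ := fun n => smoothJump T x (n + 1) ^ p with hγ
  set Q : ℝ := 2 ^ (p - 1) with hQdef
  rcases hlog.eq_or_lt with hnm | hnm
  · rw [← hnm] at h2' ⊢
    have hs := norm_ergAvg_sub_rpow_le T x hp h1 htt h2'
    have hR : dyadicPrimitive γ t' - dyadicPrimitive γ t = (t' / 2 ^ n - t / 2 ^ n) * γ n := by
      rw [dyadicPrimitive_eq γ h1 h2, dyadicPrimitive_eq γ (h1.trans htt) h2']; ring
    change _ ≤ 9 ^ p * ((t' / 2 ^ n - t / 2 ^ n) * γ n) at hs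
    rw [← hR] at hs
    have h0 : 0 ≤ 9 ^ p * (dyadicPrimitive γ t' - dyadicPrimitive γ t) :=
      (Real.rpow_nonneg (norm_nonneg _) p).trans hs
    have hQQ : 1 ≤ Q * Q := one_le_mul_of_one_le_of_one_le hQ hQ
    linarith [le_mul_of_one_le_left h0 hQQ]
  · have hpow : 2 ^ (n + 1) ≤ 2 ^ m := Nat.pow_le_pow_right (by norm_num) hnm
    have s1 := norm_ergAvg_sub_rpow_le T x hp h1 h2 le_rfl
    have s3 := norm_ergAvg_sub_rpow_le T x hp le_rfl h1' h2'
    have s2 := h.norm_ergAvg_two_pow_sub_le T x (by linarith) hc (Nat.succ_le_of_lt hnm)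
    have hΦ : ‖ergAvg T (2 ^ (n + 1)) x‖ ^ p ≤ ‖ergAvg T (2 ^ n) x‖ ^ p :=
      h.antitone_norm_ergAvg T x (by linarith) hc (Nat.le_succ n)
    change _ ≤ 9 ^ p * (_ * γ n) at s1
    change _ ≤ 9 ^ p * (_ * γ m) at s3
    have hR : (((2 ^ (n + 1) : ℕ) : ℝ) / 2 ^ n - t / 2 ^ n) * γ n
        + ((t' : ℝ) / 2 ^ m - (2 ^ m : ℕ) / 2 ^ m) * γ m
        ≤ dyadicPrimitive γ t' - dyadicPrimitive γ t := by
      rw [dyadicPrimitive_eq γ h1 h2, dyadicPrimitive_eq γ h1' h2']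
      have hsub : ∑ j ∈ range (n + 1), γ j ≤ ∑ j ∈ range m, γ j :=
        sum_le_sum_of_subset_of_nonneg (range_mono hnm) fun j _ _ => hg _
      rw [sum_range_succ] at hsub
      have e1 : ((2 ^ (n + 1) : ℕ) : ℝ) / 2 ^ n = 2 := by push_cast; rw [pow_succ]; field_simp
      have e2 : ((2 ^ m : ℕ) : ℝ) / 2 ^ m = 1 := by push_cast; field_simp
      rw [e1, e2]
      linarith
    have hR2 : smoothJump T x m ^ p ≤ ∑ j ∈ range (m + 1), smoothJump T x j ^ p
        - ∑ j ∈ range (n + 1), smoothJump T x j ^ p := by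
      rw [sum_range_succ _ m]
      have : ∑ j ∈ range (n + 1), smoothJump T x j ^ p ≤ ∑ j ∈ range m, smoothJump T x j ^ p :=
        sum_le_sum_of_subset_of_nonneg (range_mono hnm) fun j _ _ => hg _
      linarith
    set u := ergAvg T t x
    set v := ergAvg T (2 ^ (n + 1)) x
    set w := ergAvg T (2 ^ m) x
    set z := ergAvg T t' x
    have hp1 : 1 ≤ p := by linarith
    have tri : ‖z - u‖ ≤ ‖v - u‖ + (‖v - w‖ + ‖z - w‖) := by
      calc ‖z - u‖ = ‖(v - u) - ((v - w) - (z - w))‖ := by congr 1; abel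
        _ ≤ _ := (norm_sub_le _ _).trans (add_le_add_right (norm_sub_le _ _) _)
    have hsplit : ‖z - u‖ ^ p ≤ Q * Q * (‖v - u‖ ^ p + (‖v - w‖ ^ p + ‖z - w‖ ^ p)) := by
      have h0 : 0 ≤ ‖v - u‖ ^ p := Real.rpow_nonneg (norm_nonneg _) p
      calc ‖z - u‖ ^ p ≤ (‖v - u‖ + (‖v - w‖ + ‖z - w‖)) ^ p :=
            Real.rpow_le_rpow (norm_nonneg _) tri (by linarith)
        _ ≤ Q * (‖v - u‖ ^ p + (‖v - w‖ + ‖z - w‖) ^ p) :=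
            Real.add_rpow_le_two_rpow_mul hp1 (norm_nonneg _) (by positivity)
        _ ≤ Q * (Q * ‖v - u‖ ^ p + Q * (‖v - w‖ ^ p + ‖z - w‖ ^ p)) := by
            gcongr
            · exact le_mul_of_one_le_left h0 hQ
            · exact Real.add_rpow_le_two_rpow_mul hp1 (norm_nonneg _) (norm_nonneg _)
        _ = _ := by ring
    rw [← mul_sub]
    refine hsplit.trans (mul_le_mul_of_nonneg_left ?_ (by positivity))
    have r1 := mul_le_mul_of_nonneg_left hR (Real.rpow_nonneg (by norm_num : (0 : ℝ) ≤ 9) p)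
    have r2 : Q * (c⁻¹ * (‖v‖ ^ p - ‖w‖ ^ p) + 3 ^ p * smoothJump T x m ^ p)
        ≤ Q * (c⁻¹ * (‖ergAvg T (2 ^ n) x‖ ^ p - ‖w‖ ^ p)
          + 3 ^ p * (∑ j ∈ range (m + 1), smoothJump T x j ^ p
            - ∑ j ∈ range (n + 1), smoothJump T x j ^ p)) := by gcongr
    linarith

/-- The constant in the variational inequality for isometries of a space satisfying
`TwoPoint p c`. -/
noncomputable def variationConst (p c : ℝ) : ℝ :=
  2 ^ (p - 1) * 2 ^ (p - 1) * (9 ^ p * ((1 - (√2)⁻¹) ^ (-p) * c⁻¹) +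
    2 ^ (p - 1) * (3 ^ p * ((1 - (√2)⁻¹) ^ (-p) * c⁻¹) + c⁻¹))

theorem variationConst_pos (hc : 0 < c) : 0 < variationConst p c := by
  have : 0 < (1 - (√2)⁻¹ : ℝ) := sub_pos.2 inv_sqrt_two_lt_one
  rw [variationConst]
  positivity

theorem TwoPoint.sum_jump_rpow_le (h : TwoPoint p c X) (hp : 2 ≤ p) (hc : 0 < c) {t : ℕ → ℕ}
    (htm : Monotone t) (ht : ∀ k, 0 < t k) (n : ℕ) :
    ∑ k ∈ range n, ‖ergAvg T (t (k + 1)) x - ergAvg T (t k) x‖ ^ p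
      ≤ variationConst p c * ‖x‖ ^ p := by
  have hg : ∀ l, 0 ≤ smoothJump T x l ^ p := fun l => Real.rpow_nonneg (smoothJump_nonneg T x l) p
  have hG := h.sum_smoothJump_rpow_le T x (by linarith) hc
  set D := (1 - (√2)⁻¹ : ℝ) ^ (-p) * c⁻¹ with hD
  have hpot : ∑ k ∈ range n, ‖ergAvg T (t (k + 1)) x - ergAvg T (t k) x‖ ^ p
      ≤ jumpPotential T x p c (t n) - jumpPotential T x p c (t 0) := by
    rw [← sum_range_sub fun k => jumpPotential T x p c (t k)]
    exact sum_le_sum fun k _ => h.jump_le_potential_sub T x hp hc (ht k) (htm k.le_succ)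
  refine hpot.trans ?_
  have hub := (dyadicPrimitive_mem_Icc (γ := fun n => smoothJump T x (n + 1) ^ p)
    (fun _ => hg _) (ht n)).2
  have hub' : dyadicPrimitive (fun n => smoothJump T x (n + 1) ^ p) (t n) ≤ D * ‖x‖ ^ p := by
    refine hub.trans (le_trans ?_ (hG (Nat.log 2 (t n) + 2)))
    rw [sum_range_succ' _ (Nat.log 2 (t n) + 1)]
    exact le_add_of_nonneg_right (hg 0)
  have hlb : 0 ≤ dyadicPrimitive (fun n => smoothJump T x (n + 1) ^ p) (t 0) :=
    (sum_nonneg fun _ _ => hg _).trans (dyadicPrimitive_mem_Icc (fun _ => hg _) (ht 0)).1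
  have hΦ : ‖ergAvg T (2 ^ Nat.log 2 (t 0)) x‖ ^ p ≤ ‖x‖ ^ p := by
    have := h.antitone_norm_ergAvg T x (by linarith) hc (Nat.zero_le (Nat.log 2 (t 0)))
    simp only [norm_ergAvg_two_pow_zero] at this
    exact this
  have hΦn : 0 ≤ ‖ergAvg T (2 ^ Nat.log 2 (t n)) x‖ ^ p := Real.rpow_nonneg (norm_nonneg _) p
  have hR2 := hG (Nat.log 2 (t n) + 1)
  have hR20 : 0 ≤ ∑ j ∈ range (Nat.log 2 (t 0) + 1), smoothJump T x j ^ p :=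
    sum_nonneg fun _ _ => hg _
  rw [jumpPotential, jumpPotential, variationConst, ← hD, ← mul_sub, mul_assoc _ _ (‖x‖ ^ p)]
  refine mul_le_mul_of_nonneg_left ?_ (by positivity)
  have hup : 9 ^ p * dyadicPrimitive (fun n => smoothJump T x (n + 1) ^ p) (t n) +
      2 ^ (p - 1) * (3 ^ p * ∑ j ∈ range (Nat.log 2 (t n) + 1), smoothJump T x j ^ p
        - c⁻¹ * ‖ergAvg T (2 ^ Nat.log 2 (t n)) x‖ ^ p)
      ≤ 9 ^ p * (D * ‖x‖ ^ p) + 2 ^ (p - 1) * (3 ^ p * (D * ‖x‖ ^ p) - c⁻¹ * 0) := by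
    gcongr
  have hlow : 9 ^ p * 0 + 2 ^ (p - 1) * (3 ^ p * 0 - c⁻¹ * ‖x‖ ^ p)
      ≤ 9 ^ p * dyadicPrimitive (fun n => smoothJump T x (n + 1) ^ p) (t 0) +
      2 ^ (p - 1) * (3 ^ p * ∑ j ∈ range (Nat.log 2 (t 0) + 1), smoothJump T x j ^ p
        - c⁻¹ * ‖ergAvg T (2 ^ Nat.log 2 (t 0)) x‖ ^ p) := by
    gcongr
  linarith
end

section lp
variable {B : Type*} [NormedAddCommGroup B] [NormedSpace ℝ B] {p : ℝ}

theorem lp.hasSum_norm_rpow {ι B : Type*} [NormedAddCommGroup B] {p : ℝ} (hp : 0 < p)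
    (f : lp (fun _ : ι => B) (ENNReal.ofReal p)) : HasSum (fun i => ‖f i‖ ^ p) (‖f‖ ^ p) := by
  have := lp.hasSum_norm (by rwa [ENNReal.toReal_ofReal hp.le]) f
  rwa [ENNReal.toReal_ofReal hp.le] at this

theorem TwoPoint.lp {ι : Type*} {c : ℝ} (h : TwoPoint p c B) (hp : 0 < p)
    [Fact (1 ≤ ENNReal.ofReal p)] : TwoPoint p c (lp (fun _ : ι => B) (ENNReal.ofReal p)) :=
  fun f g => hasSum_le (fun i => h (f i) (g i))
    ((lp.hasSum_norm_rpow hp ((1 / 2 : ℝ) • (f + g))).add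
      ((lp.hasSum_norm_rpow hp (f - g)).mul_left c))
    (((lp.hasSum_norm_rpow hp f).add (lp.hasSum_norm_rpow hp g)).div_const 2)

/-- The left shift on `ℓ^p(ℤ; B)`. -/
noncomputable def lpShift (B : Type*) [NormedAddCommGroup B] [NormedSpace ℝ B] {p : ℝ} (hp : 0 < p)
    [Fact (1 ≤ ENNReal.ofReal p)] :
    lp (fun _ : ℤ => B) (ENNReal.ofReal p) →ₗᵢ[ℝ] lp (fun _ : ℤ => B) (ENNReal.ofReal p) where
  toFun f := ⟨fun i => f (i + 1), memℓp_gen (by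
    rw [ENNReal.toReal_ofReal hp.le]
    exact (Equiv.addRight (1 : ℤ)).summable_iff.2 (lp.hasSum_norm_rpow hp f).summable)⟩
  map_add' _ _ := rfl
  map_smul' _ _ := rfl
  norm_map' f := by
    refine (Real.rpow_left_inj (norm_nonneg _) (norm_nonneg _) hp.ne').1 ?_
    exact (lp.hasSum_norm_rpow hp _).unique
      ((Equiv.addRight (1 : ℤ)).hasSum_iff.2 (lp.hasSum_norm_rpow hp f))

theorem lpShift_pow_apply (hp : 0 < p) [Fact (1 ≤ ENNReal.ofReal p)] (n : ℕ)
    (f : lp (fun _ : ℤ => B) (ENNReal.ofReal p)) (i : ℤ) :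
    (lpShift B hp ^ n) f i = f (i + n) := by
  induction n generalizing i with
  | zero => simp
  | succ n ih =>
    rw [pow_succ', LinearIsometry.coe_mul, Function.comp_apply]
    change (lpShift B hp ^ n) f (i + 1) = _
    rw [ih, show i + 1 + (n : ℤ) = i + ((n + 1 : ℕ) : ℤ) by push_cast; ring]

theorem ergAvg_lpShift_apply (hp : 0 < p) [Fact (1 ≤ ENNReal.ofReal p)] (n : ℕ)
    (f : lp (fun _ : ℤ => B) (ENNReal.ofReal p)) (i : ℤ) :
    ergAvg (lpShift B hp) n f i = shiftAvg n f i := by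
  rw [ergAvg, ergSum, lp.coeFn_smul, Pi.smul_apply, lp.coeFn_sum, Finset.sum_apply, shiftAvg]
  simp only [lpShift_pow_apply]

theorem lp.tsum_nnnorm_rpow {ι B : Type*} [NormedAddCommGroup B] {p : ℝ} (hp : 0 < p)
    (f : lp (fun _ : ι => B) (ENNReal.ofReal p)) :
    ∑' i, (‖f i‖₊ : ℝ≥0∞) ^ p = ENNReal.ofReal (‖f‖ ^ p) := by
  rw [← (lp.hasSum_norm_rpow hp f).tsum_eq, ENNReal.ofReal_tsum_of_nonneg
    (fun i => Real.rpow_nonneg (norm_nonneg _) p) (lp.hasSum_norm_rpow hp f).summable]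
  refine tsum_congr fun i => ?_
  rw [← ENNReal.ofReal_rpow_of_nonneg (norm_nonneg _) hp.le, ofReal_norm, enorm_eq_nnnorm]
end lp

/-- For `p ≥ 2`, `K > 0` there is `C > 0` depending only on `p` and `K` such that for every real
Banach space `B` with modulus of uniform convexity `η(ε) = K ε^p`, every `f ∈ ℓ^p(B)` and every
strictly increasing sequence `(t k)` of positive integers,
`∑ₖ ‖A_{t(k+1)} f − A_{t k} f‖_{ℓ^p(B)}^p ≤ C ‖f‖_{ℓ^p(B)}^p`
(the `p`-th powers of `ℓ^p(B)` norms written out as sums over `ℤ`, in `ℝ≥0∞`). -/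
theorem stmt6 (p K : ℝ) (hp : 2 ≤ p) (hK : 0 < K) :
    ∃ C : ℝ, 0 < C ∧
      ∀ (B : Type*) [NormedAddCommGroup B] [NormedSpace ℝ B] [CompleteSpace B],
        (∀ ε ∈ Set.Ioc (0 : ℝ) 2, ∀ x y : B, ‖x‖ ≤ 1 → ‖y‖ ≤ 1 → ε ≤ ‖x - y‖ →
          ‖(1 / 2 : ℝ) • (x + y)‖ ≤ 1 - K * ε ^ p) →
        ∀ f : ℤ → B, Memℓp f (ENNReal.ofReal p) →
        ∀ t : ℕ → ℕ, StrictMono t → (∀ k, 0 < t k) →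
          ∑' k : ℕ, ∑' x : ℤ,
              (‖shiftAvg (t (k + 1)) f x - shiftAvg (t k) f x‖₊ : ℝ≥0∞) ^ p
            ≤ ENNReal.ofReal C * ∑' x : ℤ, (‖f x‖₊ : ℝ≥0∞) ^ p := by
  have hp0 : 0 < p := by linarith
  have hp1 : Fact (1 ≤ ENNReal.ofReal p) := ⟨by rw [ENNReal.one_le_ofReal]; linarith⟩
  have hc : 0 < 2 ^ (1 - p) * min (2 ^ (1 - p) * K) (2 ^ (-p)) := by positivity
  refine ⟨variationConst p (2 ^ (1 - p) * min (2 ^ (1 - p) * K) (2 ^ (-p))),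
    variationConst_pos hc, ?_⟩
  intro B _ _ _ hB f hf t ht ht0
  let F : lp (fun _ : ℤ => B) (ENNReal.ofReal p) := ⟨f, hf⟩
  have hjump : ∀ k, ∑' x : ℤ, (‖shiftAvg (t (k + 1)) f x - shiftAvg (t k) f x‖₊ : ℝ≥0∞) ^ p
      = ENNReal.ofReal (‖ergAvg (lpShift B hp0) (t (k + 1)) F
          - ergAvg (lpShift B hp0) (t k) F‖ ^ p) := fun k => by
    rw [← lp.tsum_nnnorm_rpow hp0]
    simp only [lp.coeFn_sub, Pi.sub_apply, ergAvg_lpShift_apply]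
    rfl
  have hF : ∑' x : ℤ, (‖f x‖₊ : ℝ≥0∞) ^ p = ENNReal.ofReal (‖F‖ ^ p) :=
    lp.tsum_nnnorm_rpow hp0 F
  rw [hF, ← ENNReal.ofReal_mul (variationConst_pos hc).le]
  refine ENNReal.tsum_le_of_sum_range_le fun n => ?_
  simp only [hjump]
  rw [← ENNReal.ofReal_sum_of_nonneg fun k _ => Real.rpow_nonneg (norm_nonneg _) p]
  exact ENNReal.ofReal_le_ofReal
    (((twoPoint_of_modulus hp hK hB).lp hp0).sum_jump_rpow_le _ F hp hc ht.monotone ht0 n)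
end
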